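/- (Lipschitz bound above the lower line.) Let $\gamma\in(0,1)$ and $\eta>0$ satisfy $2\eta>\gamma$ and $\gamma^2+2\eta\gamma<2$, and let $A\ge\gamma+\eta+2$. For $t\ge 0$ and a standard Brownian motion $B$ started at $z$, define recursively $\hat T^t_0:=0$ and for $k\ge 1$: $\hat R^t_k:=\inf\{s\ge \hat T^t_{k-1}: B_s\le \gamma(t+s)\}$ and $\hat T^t_k:=\inf\{s\ge \hat R^t_k: B_s=A+(\eta+\gamma)(t+s)\}$, and set $F_t(z):=\mathbb{E}_z\Big[\sum_{i=1}^{\infty}\mathbf{1}_{\{\hat T^t_i<\infty\}}\big(A+\eta(\hat T^t_i+t)\big)\,e^{(\gamma\eta+\frac{\gamma^2}{2})(\hat T^t_i+t)}\Big]$. Then there exists a constant $C=C(A,\eta,\gamma)$ such that for all $t\ge 0$ and all $x,y\ge \gamma t$, $|F_t(x)-F_t(y)|\le C\,(t+1)\,e^{(\gamma\eta+\frac{\gamma^2}{2})t}\,|x-y|$. -/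

import Mathlib

open MeasureTheory ProbabilityTheory Filter Real
open scoped ENNReal Classical

noncomputable section

/-- A standard one-dimensional Brownian motion started at `w`: a.s.-everywhere continuous
sample paths, `B 0 = w`, all finite linear combinations of (recentered) marginals at
nonnegative times are centered Gaussian, and covariance `𝔼[(B_s - w)(B_t - w)] = s ∧ t`. -/
structure IsBMFrom (Ω : Type) [MeasurableSpace Ω] (P : Measure Ω)
    (B : ℝ → Ω → ℝ) (w : ℝ) : Prop where
  meas : ∀ t, Measurable (B t)
  cont : ∀ ω, Continuous fun t => B t ω
  start : ∀ ω, B 0 ω = w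
  gaussian : ∀ (n : ℕ) (c : Fin n → ℝ) (t : Fin n → ℝ), (∀ i, 0 ≤ t i) →
    ∃ v : NNReal,
      Measure.map (fun ω => ∑ i, c i * (B (t i) ω - w)) P = gaussianReal 0 v
  cov : ∀ s t : ℝ, 0 ≤ s → 0 ≤ t →
    (∫ ω, (B s ω - w) * (B t ω - w) ∂P) = min s t

/-- First time `s ≥ τ(ω)` (with `s ≥ 0`) at which the path `s ↦ f s ω` satisfies the
condition `pred s (f s ω)`, with values in `ℝ≥0∞` and the convention `inf ∅ = ∞`. -/
def hitTimeFrom {Ω : Type} (f : ℝ → Ω → ℝ) (pred : ℝ → ℝ → Prop)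
    (τ : Ω → ℝ≥0∞) (ω : Ω) : ℝ≥0∞ :=
  sInf {u : ℝ≥0∞ | ∃ s : ℝ, 0 ≤ s ∧ u = ENNReal.ofReal s ∧
    τ ω ≤ ENNReal.ofReal s ∧ pred s (f s ω)}

/-- The stopping times `(T̂^t_k, R̂^t_k)` for the path `s ↦ z + B_s`:
`T̂^t_0 = 0`, `R̂^t_k = inf{s ≥ T̂^t_{k-1} : z + B_s ≤ γ(t+s)}` and
`T̂^t_k = inf{s ≥ R̂^t_k : z + B_s = A + (η+γ)(t+s)}`. The first component of
`hatTimes B γ η A t z k` is `T̂^t_k`, the second is `R̂^t_k` (a dummy at `k = 0`). -/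
def hatTimes {Ω : Type} (B : ℝ → Ω → ℝ) (γ η A t z : ℝ) :
    ℕ → ((Ω → ℝ≥0∞) × (Ω → ℝ≥0∞))
  | 0 => (fun _ => 0, fun _ => 0)
  | k + 1 =>
      let Tprev := (hatTimes B γ η A t z k).1
      let R := hitTimeFrom (fun s ω => z + B s ω) (fun s v => v ≤ γ * (t + s)) Tprev
      let T := hitTimeFrom (fun s ω => z + B s ω)
        (fun s v => v = A + (η + γ) * (t + s)) R
      (T, R)

/-- The summand `1_{τ < ∞} (A + η(τ + t)) e^{(γη + γ²/2)(τ + t)}`, as an element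
of `ℝ≥0∞`. -/
def bmTerm (γ η A t : ℝ) (τ : ℝ≥0∞) : ℝ≥0∞ :=
  if τ = ⊤ then 0
  else ENNReal.ofReal ((A + η * (τ.toReal + t))
    * Real.exp ((γ * η + γ ^ 2 / 2) * (τ.toReal + t)))

/-- `F_t(z) = 𝔼_z[∑_{i≥1} 1_{T̂^t_i < ∞} (A + η(T̂^t_i + t)) e^{(γη+γ²/2)(T̂^t_i + t)}]`,
realized via the Brownian motion `z + B` where `B` starts at `0`. -/
def Fhat {Ω : Type} [MeasurableSpace Ω] (P : Measure Ω) (B : ℝ → Ω → ℝ)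
    (γ η A t z : ℝ) : ℝ≥0∞ :=
  ∫⁻ ω, ∑' i : ℕ, bmTerm γ η A t ((hatTimes B γ η A t z (i + 1)).1 ω) ∂P

section Auxiliary

open scoped NNReal Topology

variable {Ω : Type} {B : ℝ → Ω → ℝ}

lemma IsBMFrom.isGaussianProcess [MeasurableSpace Ω] {P : Measure Ω} (hB : IsBMFrom Ω P B 0) :
    IsGaussianProcess (fun (s : ℝ≥0) => B s) P where
  hasGaussianLaw I := by
    have hm : Measurable fun ω => I.restrict (fun s : ℝ≥0 => B s ω) :=
      measurable_pi_lambda _ fun s => hB.meas s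
    refine ⟨isGaussian_of_map_eq_gaussianReal fun L => ?_⟩
    let e := I.equivFin
    obtain ⟨v, hv⟩ := hB.gaussian I.card (fun i => L (Pi.single (e.symm i) 1))
      (fun i => ((e.symm i : ℝ≥0) : ℝ)) (fun i => NNReal.coe_nonneg _)
    refine ⟨0, v, ?_⟩
    rw [Measure.map_map (by fun_prop) hm, ← hv]
    congr 1
    ext ω
    simp only [Function.comp_apply, sub_zero]
    rw [e.symm.sum_comp (fun i : I => L (Pi.single i 1) * B (i : ℝ≥0) ω)]
    conv_lhs => rw [← L.sum_comp_single]
    refine Finset.sum_congr rfl fun i _ => ?_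
    have : (Pi.single i (B (i : ℝ≥0) ω) : I → ℝ) = (B (i : ℝ≥0) ω) • Pi.single i 1 := by
      rw [← Pi.single_smul]; simp
    change L (Pi.single i (B (i : ℝ≥0) ω)) = _
    rw [this, map_smul, smul_eq_mul, mul_comm]

lemma IsBMFrom.integral_eq_zero [MeasurableSpace Ω] {P : Measure Ω} (hB : IsBMFrom Ω P B 0)
    {s : ℝ} (hs : 0 ≤ s) : ∫ ω, B s ω ∂P = 0 := by
  obtain ⟨v, hv⟩ := hB.gaussian 1 (fun _ => 1) (fun _ => s) (fun _ => hs)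
  have h : Measure.map (B s) P = gaussianReal 0 v := by simpa using hv
  have := integral_map (hB.meas s).aemeasurable (f := fun x : ℝ => x) (μ := P)
    aestronglyMeasurable_id
  rw [← this, h, integral_id_gaussianReal]

lemma IsBMFrom.isPreBrownianReal [MeasurableSpace Ω] {P : Measure Ω} (hB : IsBMFrom Ω P B 0) :
    IsPreBrownianReal (fun (s : ℝ≥0) => B s) P := by
  refine hB.isGaussianProcess.isPreBrownianReal_of_covariance
    (fun s => hB.integral_eq_zero s.2) fun s r hsr => ?_
  have h (q : ℝ≥0) : ∫ ω, B q ω ∂P = 0 := hB.integral_eq_zero q.2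
  rw [covariance, h, h]
  simpa [NNReal.coe_le_coe.2 hsr] using hB.cov s r s.2 r.2

/-- The `σ`-algebra generated by the path `B` on `[0, q]`. -/
abbrev pastSigma (B : ℝ → Ω → ℝ) (q : ℝ≥0) : MeasurableSpace Ω :=
  MeasurableSpace.comap (fun ω (s : Set.Iic q) => B (s : ℝ≥0) ω) MeasurableSpace.pi

lemma measurable_pastSigma {q s : ℝ≥0} (h : s ≤ q) : Measurable[pastSigma B q] (B s) := by
  have h1 : Measurable[pastSigma B q] (fun ω (s : Set.Iic q) => B (s : ℝ≥0) ω) :=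
    comap_measurable _
  exact (measurable_pi_apply (⟨s, h⟩ : Set.Iic q)).comp h1

lemma pastSigma_mono {q r : ℝ≥0} (h : q ≤ r) : pastSigma B q ≤ pastSigma B r := by
  refine measurable_iff_comap_le.1 (@measurable_pi_lambda _ _ _ (pastSigma B r) _ _ fun s => ?_)
  exact measurable_pastSigma (s.2.trans h)

lemma IsBMFrom.pastSigma_le [MeasurableSpace Ω] {P : Measure Ω} (hB : IsBMFrom Ω P B 0)
    (q : ℝ≥0) : pastSigma B q ≤ ‹MeasurableSpace Ω› :=
  measurable_iff_comap_le.1 (measurable_pi_lambda _ fun s => hB.meas s)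

/-- The exponential martingale `exp (θ (z + B_s) - θ² (t + s) / 2)`. -/
def expMart (B : ℝ → Ω → ℝ) (t z θ s : ℝ) (ω : Ω) : ℝ≥0∞ :=
  ENNReal.ofReal (rexp (θ * (z + B s ω) - θ ^ 2 / 2 * (t + s)))

lemma measurable_expMart_pastSigma (t z θ : ℝ) (q : ℝ≥0) :
    Measurable[pastSigma B q] (expMart B t z θ q) := by
  have h := measurable_pastSigma (B := B) (le_refl q)
  unfold expMart
  measurability

lemma lintegral_exp_increment [MeasurableSpace Ω] {P : Measure Ω} (hB : IsBMFrom Ω P B 0)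
    (θ : ℝ) {q r : ℝ≥0} (h : q ≤ r) :
    ∫⁻ ω, ENNReal.ofReal (rexp (θ * (B r ω - B q ω) - θ ^ 2 / 2 * (r - q))) ∂P = 1 := by
  have hl : HasLaw (B r - B q) (gaussianReal 0 (nndist (r : ℝ) (q : ℝ))) P :=
    hB.isPreBrownianReal.hasLaw_sub r q
  have hv : ((nndist (r : ℝ) (q : ℝ) : ℝ≥0) : ℝ) = r - q := by
    rw [coe_nndist, Real.dist_eq, abs_of_nonneg (by simpa using h)]
  have hm := mgf_gaussianReal hl.map_eq θ
  have hm' : AEMeasurable (fun ω => B r ω - B q ω) P := ((hB.meas r).sub (hB.meas q)).aemeasurable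
  have hi : Integrable (fun ω => rexp (θ * (B r ω - B q ω))) P := by
    have := integrable_exp_mul_gaussianReal (μ := 0) (v := nndist (r : ℝ) (q : ℝ)) θ
    rw [← hl.map_eq] at this
    exact this.comp_aemeasurable hm'
  have hsplit : (fun ω => rexp (θ * (B r ω - B q ω) - θ ^ 2 / 2 * (r - q)))
      = fun ω => rexp (θ * (B r ω - B q ω)) * rexp (- (θ ^ 2 / 2 * (r - q))) := by
    ext ω
    rw [← Real.exp_add, sub_eq_add_neg]
  rw [← ofReal_integral_eq_lintegral_ofReal]
  · have : ∫ ω, rexp (θ * (B r ω - B q ω)) ∂P = rexp ((r - q) * θ ^ 2 / 2) := by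
      simpa [mgf, hv] using hm
    rw [hsplit, integral_mul_const, this, ← Real.exp_add]
    simp; ring_nf
  · rw [hsplit]
    exact hi.mul_const _
  · exact .of_forall fun _ => exp_nonneg _

lemma setLIntegral_expMart [MeasurableSpace Ω] {P : Measure Ω} (hB : IsBMFrom Ω P B 0)
    (t z θ : ℝ) {q r : ℝ≥0} (h : q ≤ r) {E : Set Ω} (hE : MeasurableSet[pastSigma B q] E) :
    ∫⁻ ω in E, expMart B t z θ r ω ∂P = ∫⁻ ω in E, expMart B t z θ q ω ∂P := by
  have hE' := hB.pastSigma_le q _ hE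
  rw [← lintegral_indicator hE', ← lintegral_indicator hE']
  set g : Ω → ℝ≥0∞ := fun ω =>
    ENNReal.ofReal (rexp (θ * (B r ω - B q ω) - θ ^ 2 / 2 * (r - q))) with hg
  have hfg : E.indicator (expMart B t z θ r)
      = fun ω => E.indicator (expMart B t z θ q) ω * g ω := by
    ext ω
    by_cases hω : ω ∈ E
    · simp only [Set.indicator_of_mem hω, hg, expMart]
      rw [← ENNReal.ofReal_mul (exp_nonneg _), ← Real.exp_add]
      congr 2
      ring
    · simp [Set.indicator_of_notMem hω]
  obtain ⟨d, rfl⟩ := exists_add_of_le h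
  have hind := (hB.isPreBrownianReal.indepFun_shift q).symm
  rw [hfg, lintegral_mul_eq_lintegral_mul_lintegral_of_independent_measurableSpace
    (hB.pastSigma_le q) (Mg := MeasurableSpace.comap (fun ω (s : ℝ≥0) =>
      B ((q + s : ℝ≥0) : ℝ) ω - B q ω) MeasurableSpace.pi) ?_ hind
    ((measurable_expMart_pastSigma t z θ q).indicator hE) ?_, hg,
    lintegral_exp_increment hB θ h, mul_one]
  · exact measurable_iff_comap_le.1
      (measurable_pi_lambda _ fun s => (hB.meas _).sub (hB.meas _))
  · have h1 : Measurable[MeasurableSpace.comap (fun ω (s : ℝ≥0) =>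
        B ((q + s : ℝ≥0) : ℝ) ω - B q ω) MeasurableSpace.pi]
        (fun ω (s : ℝ≥0) => B ((q + s : ℝ≥0) : ℝ) ω - B q ω) := comap_measurable _
    have h2 := (measurable_pi_apply d).comp h1
    have h3 : Measurable fun x : ℝ =>
      ENNReal.ofReal (rexp (θ * x - θ ^ 2 / 2 * ((q + d : ℝ≥0) - q))) := by fun_prop
    exact h3.comp h2

lemma lintegral_expMart [MeasurableSpace Ω] {P : Measure Ω} [IsProbabilityMeasure P]
    (hB : IsBMFrom Ω P B 0) (t z θ : ℝ) (r : ℝ≥0) :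
    ∫⁻ ω, expMart B t z θ r ω ∂P = ENNReal.ofReal (rexp (θ * z - θ ^ 2 / 2 * t)) := by
  have := setLIntegral_expMart hB t z θ (zero_le (a := r)) (@MeasurableSet.univ _ (pastSigma B 0))
  simp only [Measure.restrict_univ] at this
  rw [this]
  simp [expMart, hB.start]

lemma lintegral_eq_of_tendsto_of_sq_le [MeasurableSpace Ω] {μ : Measure Ω} [IsFiniteMeasure μ]
    {f : ℕ → Ω → ℝ≥0∞} {g : Ω → ℝ≥0∞} (hf : ∀ n, Measurable (f n))
    (hlim : ∀ᵐ ω ∂μ, Tendsto (fun n => f n ω) atTop (𝓝 (g ω))) {c C : ℝ≥0∞} (hC : C ≠ ⊤)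
    (hc : ∀ n, ∫⁻ ω, f n ω ∂μ = c) (h2 : ∀ n, ∫⁻ ω, f n ω ^ 2 ∂μ ≤ C) :
    ∫⁻ ω, g ω ∂μ = c := by
  apply le_antisymm
  · calc ∫⁻ ω, g ω ∂μ = ∫⁻ ω, liminf (fun n => f n ω) atTop ∂μ :=
          lintegral_congr_ae (hlim.mono fun ω h => h.liminf_eq.symm)
      _ ≤ liminf (fun n => ∫⁻ ω, f n ω ∂μ) atTop := lintegral_liminf_le hf
      _ = c := by simp [hc]
  · have hK (K : ℕ) : c ≤ ∫⁻ ω, g ω ∂μ + C / ((K + 1 : ℕ) : ℝ≥0∞) := by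
      set k : ℝ≥0∞ := ((K + 1 : ℕ) : ℝ≥0∞) with hk
      have hk0 : k ≠ 0 := by simp [hk]
      have hkt : k ≠ ⊤ := ENNReal.natCast_ne_top _
      have hpt (x : ℝ≥0∞) : x ≤ min x k + x ^ 2 / k := by
        rcases le_total x k with h | h
        · rw [min_eq_left h]; exact le_self_add
        · refine le_trans ?_ le_add_self
          rw [ENNReal.le_div_iff_mul_le (.inl hk0) (.inl hkt), sq]
          gcongr
      have hn (n : ℕ) : c ≤ ∫⁻ ω, min (f n ω) k ∂μ + C / k := by
        rw [← hc n]
        calc ∫⁻ ω, f n ω ∂μ ≤ ∫⁻ ω, (min (f n ω) k + f n ω ^ 2 / k) ∂μ :=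
              lintegral_mono fun ω => hpt _
          _ = ∫⁻ ω, min (f n ω) k ∂μ + (∫⁻ ω, f n ω ^ 2 ∂μ) / k := by
              rw [lintegral_add_left ((hf n).min measurable_const)]
              simp_rw [div_eq_mul_inv]
              rw [lintegral_mul_const _ ((hf n).pow_const 2)]
          _ ≤ _ := by gcongr; exact h2 n
      have ht : Tendsto (fun n => ∫⁻ ω, min (f n ω) k ∂μ) atTop (𝓝 (∫⁻ ω, min (g ω) k ∂μ)) := by
        refine tendsto_lintegral_of_dominated_convergence (fun _ => k)
          (fun n => (hf n).min measurable_const) (fun n => .of_forall fun ω => min_le_right _ _)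
          ?_ (hlim.mono fun ω h => h.min tendsto_const_nhds)
        rw [lintegral_const]
        exact ENNReal.mul_ne_top hkt (measure_ne_top _ _)
      calc c ≤ ∫⁻ ω, min (g ω) k ∂μ + C / k := ge_of_tendsto' (ht.add_const _) hn
        _ ≤ _ := by gcongr; exact min_le_left _ _
    have hz : Tendsto (fun K : ℕ => C / ((K + 1 : ℕ) : ℝ≥0∞)) atTop (𝓝 0) := by
      simpa [div_eq_mul_inv] using ENNReal.Tendsto.const_mul
        (ENNReal.tendsto_inv_nat_nhds_zero.comp (tendsto_add_atTop_nat 1)) (.inr hC)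
    simpa using ge_of_tendsto' (hz.const_add (∫⁻ ω, g ω ∂μ)) hK

/-- Stopping times for the natural filtration of `B`. -/
def IsStop (B : ℝ → Ω → ℝ) (T : Ω → ℝ≥0∞) : Prop :=
  ∀ q : ℝ≥0, MeasurableSet[pastSigma B q] {ω | T ω ≤ q}

lemma IsStop.measurable [MeasurableSpace Ω] {P : Measure Ω} (hB : IsBMFrom Ω P B 0)
    {T : Ω → ℝ≥0∞} (hT : IsStop B T) : Measurable T := by
  refine measurable_of_Iic fun a => ?_
  rcases eq_or_ne a ⊤ with rfl | h
  · simp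
  · lift a to ℝ≥0 using h
    exact hB.pastSigma_le a _ (hT a)

lemma continuous_expMart [MeasurableSpace Ω] {P : Measure Ω} (hB : IsBMFrom Ω P B 0)
    (t z θ : ℝ) (ω : Ω) : Continuous fun s => expMart B t z θ s ω := by
  have := hB.cont ω
  exact ENNReal.continuous_ofReal.comp (by fun_prop)

lemma measurable_expMart [MeasurableSpace Ω] {P : Measure Ω} (hB : IsBMFrom Ω P B 0)
    (t z θ : ℝ) {τ : Ω → ℝ} (hτ : Measurable τ) :
    Measurable fun ω => expMart B t z θ (τ ω) ω := by
  have h : Measurable (Function.uncurry B) :=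
    measurable_uncurry_of_continuous_of_measurable hB.cont hB.meas
  have h2 : Measurable fun ω => B (τ ω) ω := h.comp (hτ.prodMk measurable_id)
  unfold expMart
  fun_prop

lemma expMart_sq (B : ℝ → Ω → ℝ) (t z θ s : ℝ) (ω : Ω) :
    expMart B t z θ s ω ^ 2
      = ENNReal.ofReal (rexp (θ ^ 2 * (t + s))) * expMart B t z (2 * θ) s ω := by
  unfold expMart
  rw [← ENNReal.ofReal_pow (exp_nonneg _), ← ENNReal.ofReal_mul (exp_nonneg _), ← Real.exp_add,
    ← Real.exp_nat_mul]
  congr 2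
  push_cast
  ring

/-- Rounding of `T` up to the grid of mesh `1 / (n + 1)`. -/
def gridTime (T : Ω → ℝ≥0∞) (n : ℕ) (ω : Ω) : ℝ :=
  (⌈(T ω).toReal * (n + 1 : ℝ)⌉₊ : ℝ) / (n + 1)

lemma toReal_le_iff_ceil {x : ℝ≥0∞} (hx : x ≠ ⊤) (n k : ℕ) :
    ⌈x.toReal * (n + 1 : ℝ)⌉₊ ≤ k ↔ x ≤ ((k / (n + 1) : ℝ≥0) : ℝ≥0∞) := by
  lift x to ℝ≥0 using hx
  rw [Nat.ceil_le, ENNReal.coe_le_coe, le_div_iff₀ (by positivity), ← NNReal.coe_le_coe]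
  simp

lemma setLIntegral_expMart_gridTime [MeasurableSpace Ω] {P : Measure Ω} (hB : IsBMFrom Ω P B 0)
    (t z θ : ℝ) {T : Ω → ℝ≥0∞} (hT : IsStop B T) (N n : ℕ) :
    ∫⁻ ω in {ω | T ω ≤ N}, expMart B t z θ (gridTime T n ω) ω ∂P
      = ∫⁻ ω in {ω | T ω ≤ N}, expMart B t z θ N ω ∂P := by
  set E : ℕ → Set Ω := fun k => {ω | T ω ≤ N ∧ ⌈(T ω).toReal * (n + 1 : ℝ)⌉₊ = k} with hE
  have hTm := hT.measurable hB
  have hEm (k : ℕ) : MeasurableSet (E k) := by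
    refine (measurableSet_le hTm measurable_const).inter (measurableSet_eq_fun ?_ measurable_const)
    exact Nat.measurable_ceil.comp (hTm.ennreal_toReal.mul_const _)
  have hU : {ω | T ω ≤ N} = ⋃ k, E k := by
    ext ω; simp [hE]
  have hd : Pairwise (Function.onFun Disjoint E) := fun i j hij =>
    Set.disjoint_left.2 fun ω h h' => hij (h.2.symm.trans h'.2)
  rw [hU, lintegral_iUnion hEm hd, lintegral_iUnion hEm hd]
  congr 1
  ext k
  by_cases hk : k ≤ N * (n + 1)
  · have hEk : E k = {ω | T ω ≤ ((k / (n + 1) : ℝ≥0) : ℝ≥0∞)} \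
        ⋃ j ∈ Finset.range k, {ω | T ω ≤ ((j / (n + 1) : ℝ≥0) : ℝ≥0∞)} := by
      ext ω
      rcases eq_or_ne (T ω) ⊤ with h | h
      · simp only [hE, Set.mem_ofPred_eq, Set.mem_sdiff, h, top_le_iff, ENNReal.coe_ne_top,
          ENNReal.natCast_ne_top, false_and]
      have hN : T ω ≤ N ↔ ⌈(T ω).toReal * (n + 1 : ℝ)⌉₊ ≤ N * (n + 1) := by
        rw [toReal_le_iff_ceil h]
        have : (((N * (n + 1) : ℕ) : ℝ≥0) / (n + 1)) = N := by
          push_cast; field_simp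
        rw [this]; simp
      simp only [hE, Set.mem_ofPred_eq, Set.mem_sdiff, Set.mem_iUnion, Finset.mem_range, hN,
        ← toReal_le_iff_ceil h]
      constructor
      · rintro ⟨_, h2⟩
        exact ⟨h2.le, by push Not; intro j hj; omega⟩
      · rintro ⟨h1, h2⟩
        push Not at h2
        have : ⌈(T ω).toReal * (n + 1 : ℝ)⌉₊ = k := by
          by_contra hne
          exact absurd (h2 _ (lt_of_le_of_ne h1 hne)) (lt_irrefl _)
        exact ⟨this.le.trans hk, this⟩
    have hEp : MeasurableSet[pastSigma B (k / (n + 1))] (E k) := by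
      rw [hEk]
      refine MeasurableSet.diff (hT _) (Finset.measurableSet_biUnion _ fun j hj => ?_)
      refine pastSigma_mono ?_ _ (hT _)
      gcongr
      exact (Finset.mem_range.1 hj).le
    have hkN : (k / (n + 1) : ℝ≥0) ≤ N := by
      rw [div_le_iff₀ (by positivity)]
      exact_mod_cast hk
    have := setLIntegral_expMart hB t z θ hkN hEp
    rw [NNReal.coe_natCast] at this
    rw [this]
    refine setLIntegral_congr_fun (hEm k) fun ω hω => ?_
    simp only [gridTime, hω.2]
    push_cast
    rfl
  · have : E k = ∅ := by
      ext ω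
      simp only [hE, Set.mem_ofPred_eq, Set.mem_empty_iff_false, iff_false, not_and]
      intro h1 h2
      apply hk
      have hx : T ω ≠ ⊤ := ne_top_of_le_ne_top (ENNReal.natCast_ne_top N) h1
      rw [← h2, toReal_le_iff_ceil hx]
      have : (((N * (n + 1) : ℕ) : ℝ≥0) / (n + 1)) = N := by
        push_cast; field_simp
      rw [this]; simpa using h1
    simp [this]

lemma tendsto_gridTime (T : Ω → ℝ≥0∞) (ω : Ω) :
    Tendsto (fun n => gridTime T n ω) atTop (𝓝 (T ω).toReal) := by
  have h := (tendsto_nat_ceil_mul_div_atTop (R := ℝ) (ENNReal.toReal_nonneg (a := T ω))).comp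
    (tendsto_natCast_atTop_atTop.comp (tendsto_add_atTop_nat 1))
  refine h.congr fun n => ?_
  simp [gridTime]

lemma gridTime_le {T : Ω → ℝ≥0∞} {ω : Ω} {N : ℕ} (h : T ω ≤ N) (n : ℕ) :
    gridTime T n ω ≤ N := by
  have hx : T ω ≠ ⊤ := ne_top_of_le_ne_top (ENNReal.natCast_ne_top N) h
  unfold gridTime
  rw [div_le_iff₀ (by positivity)]
  have : ⌈(T ω).toReal * (n + 1 : ℝ)⌉₊ ≤ N * (n + 1) := by
    rw [Nat.ceil_le]
    push_cast
    gcongr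
    simpa using ENNReal.toReal_mono (ENNReal.natCast_ne_top N) h
  exact_mod_cast this

/-- Optional sampling for the exponential martingale. -/
lemma setLIntegral_expMart_toReal [MeasurableSpace Ω] {P : Measure Ω} [IsProbabilityMeasure P]
    (hB : IsBMFrom Ω P B 0) (t z θ : ℝ) {T : Ω → ℝ≥0∞} (hT : IsStop B T) (N : ℕ) :
    ∫⁻ ω in {ω | T ω ≤ N}, expMart B t z θ (T ω).toReal ω ∂P
      = ∫⁻ ω in {ω | T ω ≤ N}, expMart B t z θ N ω ∂P := by
  have hTm := hT.measurable hB
  have hset : MeasurableSet {ω | T ω ≤ N} := measurableSet_le hTm measurable_const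
  have hgm (n : ℕ) : Measurable (gridTime T n) := by
    unfold gridTime
    exact ((measurable_from_top (f := fun k : ℕ => (k : ℝ))).comp
      (Nat.measurable_ceil.comp (hTm.ennreal_toReal.mul_const _))).div_const _
  refine lintegral_eq_of_tendsto_of_sq_le
    (f := fun n ω => expMart B t z θ (gridTime T n ω) ω)
    (C := ENNReal.ofReal (rexp (θ ^ 2 * (t + N))) *
      ENNReal.ofReal (rexp (2 * θ * z - (2 * θ) ^ 2 / 2 * t)))
    (fun n => measurable_expMart hB t z θ (hgm n))
    (.of_forall fun ω => ((continuous_expMart hB t z θ ω).tendsto _).comp (tendsto_gridTime T ω))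
    (ENNReal.mul_ne_top ENNReal.ofReal_ne_top ENNReal.ofReal_ne_top)
    (setLIntegral_expMart_gridTime hB t z θ hT N) fun n => ?_
  calc ∫⁻ ω in {ω | T ω ≤ N}, expMart B t z θ (gridTime T n ω) ω ^ 2 ∂P
      ≤ ∫⁻ ω in {ω | T ω ≤ N}, ENNReal.ofReal (rexp (θ ^ 2 * (t + N))) *
          expMart B t z (2 * θ) (gridTime T n ω) ω ∂P := by
        refine setLIntegral_mono' hset fun ω hω => ?_
        rw [expMart_sq]
        have := gridTime_le hω n
        gcongr
    _ = ENNReal.ofReal (rexp (θ ^ 2 * (t + N))) *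
          ∫⁻ ω in {ω | T ω ≤ N}, expMart B t z (2 * θ) N ω ∂P := by
        rw [lintegral_const_mul _ (measurable_expMart hB t z _ (hgm n)),
          setLIntegral_expMart_gridTime hB t z (2 * θ) hT N n]
    _ ≤ _ := by
        gcongr
        refine (setLIntegral_le_lintegral _ _).trans ?_
        have := lintegral_expMart hB t z (2 * θ) N
        rw [NNReal.coe_natCast] at this
        rw [this]

lemma tendsto_setLIntegral_le_natCast [MeasurableSpace Ω] (μ : Measure Ω) (T : Ω → ℝ≥0∞)
    (f : Ω → ℝ≥0∞) :
    Tendsto (fun N : ℕ => ∫⁻ ω in {ω | T ω ≤ N}, f ω ∂μ) atTop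
      (𝓝 (∫⁻ ω in {ω | T ω ≠ ⊤}, f ω ∂μ)) := by
  have hmono : Monotone fun N : ℕ => {ω | T ω ≤ N} := fun i j hij ω hω =>
    le_trans (Set.mem_ofPred_eq ▸ hω) (by exact_mod_cast hij)
  have hU : {ω | T ω ≠ ⊤} = ⋃ N : ℕ, {ω | T ω ≤ N} := by
    ext ω
    simp only [Set.mem_ofPred_eq, Set.mem_iUnion]
    constructor
    · intro h
      obtain ⟨n, hn⟩ := ENNReal.exists_nat_gt h
      exact ⟨n, hn.le⟩
    · rintro ⟨n, hn⟩
      exact ne_top_of_le_ne_top (ENNReal.natCast_ne_top n) hn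
  rw [hU, setLIntegral_iUnion_of_directed _ (directed_of_isDirected_le hmono)]
  exact tendsto_atTop_iSup fun i j hij => lintegral_mono_set (hmono hij)

/-- If between `S` and `T` the process stays on one side of the line `v ↦ a + b v`, the side where
`exp (θ W - θ² v / 2)` is controlled, then the exponential martingale has the same expectation
at `S` and at `T`. -/
lemma lintegral_expMart_eq_of_barrier [MeasurableSpace Ω] {P : Measure Ω} [IsProbabilityMeasure P]
    (hB : IsBMFrom Ω P B 0) (t z θ a b : ℝ) {S T : Ω → ℝ≥0∞}
    (hS : IsStop B S) (hT : IsStop B T) (hST : ∀ ω, S ω ≤ T ω) (hθ : θ ≠ b)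
    (hbar : ∀ ω (N : ℕ), S ω ≤ N → N < T ω →
      (θ - b) * (z + B N ω) ≤ (θ - b) * (a + b * (t + N))) :
    ∫⁻ ω in {ω | T ω ≠ ⊤}, expMart B t z θ (T ω).toReal ω ∂P
      = ∫⁻ ω in {ω | S ω ≠ ⊤}, expMart B t z θ (S ω).toReal ω ∂P := by
  have hu := tendsto_setLIntegral_le_natCast P T (fun ω => expMart B t z θ (T ω).toReal ω)
  have hv := tendsto_setLIntegral_le_natCast P S (fun ω => expMart B t z θ (S ω).toReal ω)
  have hSm := hS.measurable hB
  have hTm := hT.measurable hB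
  have hTs (N : ℕ) : MeasurableSet {ω | T ω ≤ N} := measurableSet_le hTm measurable_const
  have hSs (N : ℕ) : MeasurableSet {ω | S ω ≤ N} := measurableSet_le hSm measurable_const
  set K : ℝ≥0∞ := ENNReal.ofReal (rexp ((θ + b) / 2 * z - ((θ + b) / 2) ^ 2 / 2 * t)) with hK
  set c : ℝ := 3 / 8 * (θ - b) ^ 2 with hc
  have hc0 : 0 < c := by
    have := sub_ne_zero.2 hθ
    positivity
  set e : ℕ → ℝ≥0∞ := fun N => ∫⁻ ω in {ω | S ω ≤ N} \ {ω | T ω ≤ N}, expMart B t z θ N ω ∂P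
    with he
  have he0 : Tendsto e atTop (𝓝 0) := by
    have hb (N : ℕ) : e N ≤ ENNReal.ofReal (rexp ((θ - b) / 2 * a - c * (t + N))) * K := by
      calc e N ≤ ∫⁻ ω in {ω | S ω ≤ N} \ {ω | T ω ≤ N},
            ENNReal.ofReal (rexp ((θ - b) / 2 * a - c * (t + N))) *
              expMart B t z ((θ + b) / 2) N ω ∂P := by
            refine setLIntegral_mono' ((hSs N).diff (hTs N)) fun ω hω => ?_
            have h := hbar ω N hω.1 (not_le.1 hω.2)
            rw [expMart, expMart, ← ENNReal.ofReal_mul (exp_nonneg _), ← Real.exp_add]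
            gcongr
            rw [hc]
            nlinarith
        _ ≤ ∫⁻ ω, ENNReal.ofReal (rexp ((θ - b) / 2 * a - c * (t + N))) *
              expMart B t z ((θ + b) / 2) N ω ∂P := setLIntegral_le_lintegral _ _
        _ = _ := by
            have := lintegral_expMart hB t z ((θ + b) / 2) N
            rw [NNReal.coe_natCast] at this
            rw [lintegral_const_mul _ (measurable_expMart hB t z _ measurable_const), this]
    have hlim : Tendsto (fun N : ℕ => ENNReal.ofReal (rexp ((θ - b) / 2 * a - c * (t + N))) * K)
        atTop (𝓝 0) := by
      have h1 : Tendsto (fun N : ℕ => rexp ((θ - b) / 2 * a - c * (t + N))) atTop (𝓝 0) := by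
        refine Real.tendsto_exp_atBot.comp ?_
        refine tendsto_atBot_add_const_left _ _ ?_
        refine tendsto_neg_atTop_atBot.comp (Tendsto.const_mul_atTop hc0 ?_)
        exact tendsto_atTop_add_const_left _ _ tendsto_natCast_atTop_atTop
      have h2 := ENNReal.Tendsto.mul_const (b := K) (ENNReal.tendsto_ofReal h1)
        (.inr ENNReal.ofReal_ne_top)
      simpa using h2
    exact tendsto_of_tendsto_of_tendsto_of_le_of_le tendsto_const_nhds hlim
      (fun _ => zero_le) hb
  have hrel (N : ℕ) : ∫⁻ ω in {ω | S ω ≤ N}, expMart B t z θ (S ω).toReal ω ∂P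
      = ∫⁻ ω in {ω | T ω ≤ N}, expMart B t z θ (T ω).toReal ω ∂P + e N := by
    rw [setLIntegral_expMart_toReal hB t z θ hS, setLIntegral_expMart_toReal hB t z θ hT,
      ← lintegral_inter_add_sdiff _ {ω | S ω ≤ N} (hTs N)]
    congr 3
    exact Set.inter_eq_right.2 fun ω hω => (hST ω).trans hω
  have := hu.add he0
  rw [add_zero] at this
  exact tendsto_nhds_unique this (hv.congr hrel)

section Hitting

variable {f : ℝ → Ω → ℝ} {pred : ℝ → ℝ → Prop} {h : ℝ → ℝ → ℝ} {τ : Ω → ℝ≥0∞}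

lemma hitTimeFrom_le_ofReal {ω : Ω} {s : ℝ} (hs : 0 ≤ s) (hτ : τ ω ≤ ENNReal.ofReal s)
    (hp : pred s (f s ω)) : hitTimeFrom f pred τ ω ≤ ENNReal.ofReal s :=
  sInf_le ⟨s, hs, rfl, hτ, hp⟩

lemma le_hitTimeFrom (f : ℝ → Ω → ℝ) (pred : ℝ → ℝ → Prop) (τ : Ω → ℝ≥0∞) (ω : Ω) :
    τ ω ≤ hitTimeFrom f pred τ ω := by
  refine le_sInf ?_
  rintro u ⟨s, _, rfl, h, _⟩
  exact h

lemma hitTimeFrom_mem (hh : Continuous (Function.uncurry h)) (hpred : ∀ s v, pred s v ↔ h s v ≤ 0)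
    {ω : Ω} (hf : Continuous fun s => f s ω) (hfin : hitTimeFrom f pred τ ω ≠ ⊤) :
    pred (hitTimeFrom f pred τ ω).toReal (f (hitTimeFrom f pred τ ω).toReal ω) := by
  set A : Set ℝ≥0∞ := {u : ℝ≥0∞ | ∃ s : ℝ, 0 ≤ s ∧ u = ENNReal.ofReal s ∧
    τ ω ≤ ENNReal.ofReal s ∧ pred s (f s ω)} with hA
  have hTA : hitTimeFrom f pred τ ω = sInf A := rfl
  rw [hTA] at hfin ⊢
  have hne : A.Nonempty := by
    by_contra hemp
    rw [Set.not_nonempty_iff_eq_empty] at hemp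
    exact hfin (hemp ▸ sInf_empty)
  obtain ⟨u, -, hu, huA⟩ := exists_seq_tendsto_sInf hne (OrderBot.bddBelow A)
  have hlim := (ENNReal.tendsto_toReal hfin).comp hu
  have hcont : Continuous fun s => h s (f s ω) := hh.comp (continuous_id.prodMk hf)
  rw [hpred]
  refine le_of_tendsto' ((hcont.tendsto _).comp hlim) fun n => ?_
  obtain ⟨s, hs, hus, -, hp⟩ := huA n
  simp only [Function.comp_apply, hus, ENNReal.toReal_ofReal hs]
  exact (hpred _ _).1 hp

lemma hitTimeFrom_le_coe_iff (hh : Continuous (Function.uncurry h))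
    (hpred : ∀ s v, pred s v ↔ h s v ≤ 0) {ω : Ω} (hf : Continuous fun s => f s ω) (q : ℝ≥0) :
    hitTimeFrom f pred τ ω ≤ q ↔ ∃ s : ℝ≥0, s ≤ q ∧ τ ω ≤ s ∧ h s (f s ω) ≤ 0 := by
  constructor
  · intro hq
    have hfin := ne_top_of_le_ne_top ENNReal.coe_ne_top hq
    refine ⟨(hitTimeFrom f pred τ ω).toNNReal, ?_, ?_, ?_⟩
    · rwa [← ENNReal.coe_le_coe, ENNReal.coe_toNNReal hfin]
    · rw [ENNReal.coe_toNNReal hfin]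
      exact le_hitTimeFrom ..
    · exact (hpred _ _).1 (hitTimeFrom_mem hh hpred hf hfin)
  · rintro ⟨s, hsq, hτ, hp⟩
    refine (hitTimeFrom_le_ofReal s.2 (by simpa using hτ) ((hpred _ _).2 hp)).trans ?_
    simpa using hsq

lemma IsStop.hitTimeFrom (hB : ∀ ω, Continuous fun s => B s ω) (z : ℝ)
    (hh : Continuous (Function.uncurry h)) (hpred : ∀ s v, pred s v ↔ h s v ≤ 0)
    (hτ : IsStop B τ) : IsStop B (hitTimeFrom (fun s ω => z + B s ω) pred τ) := by
  intro q
  obtain ⟨D, hDc, hDd⟩ := TopologicalSpace.exists_countable_dense ℝ≥0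
  have hcont (ω : Ω) : Continuous fun s : ℝ≥0 => h s (z + B s ω) :=
    hh.comp ((NNReal.continuous_coe).prodMk
      (continuous_const.add ((hB ω).comp NNReal.continuous_coe)))
  have key : {ω | _root_.hitTimeFrom (fun s ω => z + B s ω) pred τ ω ≤ q}
      = ⋂ n : ℕ, ⋃ r ∈ (insert q D) ∩ Set.Iic q,
        {ω | τ ω ≤ r} ∩ {ω | h r (z + B r ω) < 1 / (n + 1)} := by
    ext ω
    have hf : Continuous fun s => z + B s ω := continuous_const.add (hB ω)
    rw [Set.mem_ofPred_eq, hitTimeFrom_le_coe_iff (f := fun s ω => z + B s ω) hh hpred hf q]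
    simp only [Set.mem_iInter, Set.mem_iUnion, Set.mem_inter_iff, Set.mem_ofPred_eq, Set.mem_Iic,
      exists_prop]
    constructor
    · rintro ⟨s, hsq, hτs, hs0⟩ n
      have hpos : h s (z + B s ω) < 1 / ((n : ℝ) + 1) := hs0.trans_lt (by positivity)
      rcases hsq.eq_or_lt with rfl | hlt
      · exact ⟨s, ⟨Set.mem_insert _ _, le_rfl⟩, hτs, hpos⟩
      · have hev : ∀ᶠ r : ℝ≥0 in 𝓝[>] s,
            h r (z + B r ω) < 1 / ((n : ℝ) + 1) ∧ r ∈ Set.Ioo s q :=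
          ((((hcont ω).tendsto s).eventually_lt_const hpos).filter_mono nhdsWithin_le_nhds).and
            (Ioo_mem_nhdsGT hlt)
        obtain ⟨u, hu, hsub⟩ := (mem_nhdsGT_iff_exists_Ioo_subset).1 hev
        obtain ⟨r, hrD, hr⟩ := hDd.exists_between hu
        have hr' := hsub hr
        exact ⟨r, ⟨Set.mem_insert_of_mem _ hrD, hr'.2.2.le⟩,
          hτs.trans (by exact_mod_cast hr.1.le), hr'.1⟩
    · intro hall
      choose r hr hτr hlt using hall
      obtain ⟨s, hs, φ, hφ, hlim⟩ := (isCompact_Icc (a := (0 : ℝ≥0)) (b := q)).tendsto_subseq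
        (fun n => ⟨zero_le, (hr n).2⟩)
      refine ⟨s, hs.2, ?_, ?_⟩
      · exact ge_of_tendsto' (ENNReal.tendsto_coe.2 hlim) fun n => hτr _
      · refine le_of_tendsto_of_tendsto' (((hcont ω).tendsto s).comp hlim)
          (tendsto_one_div_add_atTop_nhds_zero_nat.comp hφ.tendsto_atTop) fun n => (hlt _).le
  rw [key]
  refine MeasurableSet.iInter fun n => ?_
  refine MeasurableSet.biUnion ((hDc.insert q).mono Set.inter_subset_left) fun r hr => ?_
  refine (pastSigma_mono hr.2 _ (hτ r)).inter ?_
  have hm : Measurable[pastSigma B q] fun ω => h r (z + B r ω) := by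
    have h1 : Measurable fun x : ℝ => h r (z + x) :=
      (hh.comp (continuous_const.prodMk (continuous_const.add continuous_id))).measurable
    exact h1.comp (measurable_pastSigma hr.2)
  exact hm measurableSet_Iio

end Hitting

section Hitting

variable {f : ℝ → Ω → ℝ} {pred : ℝ → ℝ → Prop} {g : ℝ → ℝ} {τ : Ω → ℝ≥0∞}

lemma exists_hitTimeFrom_le_of_nonpos {ω : Ω} {s : ℝ} (hg : Continuous g)
    (hp : ∀ s, g s = 0 → pred s (f s ω)) (hs : 0 ≤ s) (hτ : τ ω ≤ ENNReal.ofReal s)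
    (h0 : 0 ≤ g (τ ω).toReal) (h1 : g s ≤ 0) :
    ∃ r ≤ s, g r = 0 ∧ 0 ≤ r ∧ hitTimeFrom f pred τ ω ≤ ENNReal.ofReal r := by
  have hτs : (τ ω).toReal ≤ s := by
    simpa [ENNReal.toReal_ofReal hs] using ENNReal.toReal_mono ENNReal.ofReal_ne_top hτ
  obtain ⟨r, hr, hgr⟩ := intermediate_value_Icc' hτs hg.continuousOn ⟨h1, h0⟩
  have hr0 : 0 ≤ r := ENNReal.toReal_nonneg.trans hr.1
  refine ⟨r, hr.2, hgr, hr0, hitTimeFrom_le_ofReal hr0 ?_ (hp r hgr)⟩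
  exact (ENNReal.le_ofReal_iff_toReal_le (ne_top_of_le_ne_top ENNReal.ofReal_ne_top hτ) hr0).2 hr.1

end Hitting

lemma expMart_reflect {t z s a b : ℝ} {ω : Ω} (θ : ℝ) (h : z + B s ω = a + b * (t + s)) :
    expMart B t z θ s ω
      = ENNReal.ofReal (rexp (2 * (θ - b) * a)) * expMart B t z (2 * b - θ) s ω := by
  rw [expMart, expMart, ← ENNReal.ofReal_mul (exp_nonneg _), ← Real.exp_add, h]
  ring_nf

section HatTimes

variable {γ η A t z : ℝ}

lemma hatTimes_succ_snd (B : ℝ → Ω → ℝ) (γ η A t z : ℝ) (i : ℕ) :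
    (hatTimes B γ η A t z (i + 1)).2 = hitTimeFrom (fun s ω => z + B s ω)
      (fun s v => v ≤ γ * (t + s)) (hatTimes B γ η A t z i).1 := rfl

lemma hatTimes_succ_fst (B : ℝ → Ω → ℝ) (γ η A t z : ℝ) (i : ℕ) :
    (hatTimes B γ η A t z (i + 1)).1 = hitTimeFrom (fun s ω => z + B s ω)
      (fun s v => v = A + (η + γ) * (t + s)) (hatTimes B γ η A t z (i + 1)).2 := rfl

lemma lowerTime_le (B : ℝ → Ω → ℝ) (γ η A t z : ℝ) (i : ℕ) (ω : Ω) :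
    (hatTimes B γ η A t z i).1 ω ≤ (hatTimes B γ η A t z (i + 1)).2 ω := by
  rw [hatTimes_succ_snd]
  exact le_hitTimeFrom ..

lemma upperTime_le (B : ℝ → Ω → ℝ) (γ η A t z : ℝ) (i : ℕ) (ω : Ω) :
    (hatTimes B γ η A t z (i + 1)).2 ω ≤ (hatTimes B γ η A t z (i + 1)).1 ω := by
  rw [hatTimes_succ_fst]
  exact le_hitTimeFrom ..

lemma isStop_hatTimes (hB : ∀ ω, Continuous fun s => B s ω) (γ η A t z : ℝ) (i : ℕ) :
    IsStop B (hatTimes B γ η A t z i).1 ∧ IsStop B (hatTimes B γ η A t z i).2 := by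
  induction i with
  | zero => exact ⟨fun q => by simp [hatTimes], fun q => by simp [hatTimes]⟩
  | succ i ih =>
    have hR : IsStop B (hatTimes B γ η A t z (i + 1)).2 := by
      rw [hatTimes_succ_snd]
      exact IsStop.hitTimeFrom (h := fun s v => v - γ * (t + s)) hB z (by fun_prop) (by simp) ih.1
    refine ⟨?_, hR⟩
    rw [hatTimes_succ_fst]
    exact IsStop.hitTimeFrom (h := fun s v => |v - (A + (η + γ) * (t + s))|) hB z
      (by fun_prop) (fun s v => by simp [sub_eq_zero]) hR

lemma upperTime_spec (hB : ∀ ω, Continuous fun s => B s ω) {i : ℕ} {ω : Ω}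
    (h : (hatTimes B γ η A t z (i + 1)).1 ω ≠ ⊤) :
    z + B ((hatTimes B γ η A t z (i + 1)).1 ω).toReal ω
      = A + (γ + η) * (t + ((hatTimes B γ η A t z (i + 1)).1 ω).toReal) := by
  have := hitTimeFrom_mem (f := fun s ω => z + B s ω)
    (pred := fun s v => v = A + (η + γ) * (t + s)) (h := fun s v => |v - (A + (η + γ) * (t + s))|) (by fun_prop)
    (fun s v => by simp [sub_eq_zero]) (continuous_const.add (hB ω)) h
  rw [add_comm γ η]
  exact this

lemma lowerTime_start (hB : ∀ ω, Continuous fun s => B s ω) (hB0 : ∀ ω, B 0 ω = 0)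
    (hη : 0 < η) (hA : 0 < A) (ht : 0 ≤ t) (hz : γ * t ≤ z) {i : ℕ} {ω : Ω}
    (h : (hatTimes B γ η A t z i).1 ω ≠ ⊤) :
    0 ≤ z + B ((hatTimes B γ η A t z i).1 ω).toReal ω
      - γ * (t + ((hatTimes B γ η A t z i).1 ω).toReal) := by
  cases i with
  | zero => simpa [hatTimes, hB0] using hz
  | succ i =>
    rw [upperTime_spec hB h]
    have : 0 ≤ ((hatTimes B γ η A t z (i + 1)).1 ω).toReal := ENNReal.toReal_nonneg
    nlinarith [mul_nonneg hη.le (add_nonneg ht this)]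

lemma lowerTime_spec (hB : ∀ ω, Continuous fun s => B s ω) (hB0 : ∀ ω, B 0 ω = 0)
    (hη : 0 < η) (hA : 0 < A) (ht : 0 ≤ t) (hz : γ * t ≤ z) {i : ℕ} {ω : Ω}
    (h : (hatTimes B γ η A t z (i + 1)).2 ω ≠ ⊤) :
    z + B ((hatTimes B γ η A t z (i + 1)).2 ω).toReal ω
      = γ * (t + ((hatTimes B γ η A t z (i + 1)).2 ω).toReal) := by
  set R := (hatTimes B γ η A t z (i + 1)).2 ω with hR
  have hle : z + B R.toReal ω ≤ γ * (t + R.toReal) :=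
    hitTimeFrom_mem (f := fun s ω => z + B s ω) (pred := fun s v => v ≤ γ * (t + s))
      (h := fun s v => v - γ * (t + s)) (by fun_prop) (by simp) (continuous_const.add (hB ω)) h
  have hτ := lowerTime_le B γ η A t z i ω
  have hg : Continuous fun s => z + B s ω - γ * (t + s) := by
    have := hB ω
    fun_prop
  obtain ⟨r, hrR, hr, hr0, hRr⟩ := exists_hitTimeFrom_le_of_nonpos (f := fun s ω => z + B s ω)
    (pred := fun s v => v ≤ γ * (t + s)) (τ := (hatTimes B γ η A t z i).1) (s := R.toReal)
    hg (fun s hs => by linarith) ENNReal.toReal_nonneg (by rwa [ENNReal.ofReal_toReal h])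
    (lowerTime_start hB hB0 hη hA ht hz (ne_top_of_le_ne_top h hτ)) (by linarith)
  have hRr' : R.toReal ≤ r :=
    (ENNReal.le_ofReal_iff_toReal_le h hr0).1 hRr
  have : r = R.toReal := le_antisymm hrR hRr'
  rw [this] at hr
  linarith

lemma lt_of_lt_lowerTime {i : ℕ} {ω : Ω} {s : ℝ} (hs : 0 ≤ s)
    (h1 : (hatTimes B γ η A t z i).1 ω ≤ ENNReal.ofReal s)
    (h2 : ENNReal.ofReal s < (hatTimes B γ η A t z (i + 1)).2 ω) :
    γ * (t + s) < z + B s ω := by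
  by_contra! hle
  exact h2.not_ge (hitTimeFrom_le_ofReal (f := fun s ω => z + B s ω)
    (pred := fun s v => v ≤ γ * (t + s)) hs h1 hle)

lemma lt_of_lt_upperTime (hB : ∀ ω, Continuous fun s => B s ω) (hB0 : ∀ ω, B 0 ω = 0)
    (hη : 0 < η) (hA : 0 < A) (ht : 0 ≤ t) (hz : γ * t ≤ z) {i : ℕ} {ω : Ω} {s : ℝ} (hs : 0 ≤ s)
    (h1 : (hatTimes B γ η A t z (i + 1)).2 ω ≤ ENNReal.ofReal s)
    (h2 : ENNReal.ofReal s < (hatTimes B γ η A t z (i + 1)).1 ω) :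
    z + B s ω < A + (γ + η) * (t + s) := by
  by_contra! hle
  set R := (hatTimes B γ η A t z (i + 1)).2 ω with hR
  have hR0 : 0 ≤ R.toReal := ENNReal.toReal_nonneg
  have hRl := lowerTime_spec hB hB0 hη hA ht hz (ne_top_of_le_ne_top ENNReal.ofReal_ne_top h1)
  rw [← hR] at hRl
  have hg : Continuous fun s => A + (η + γ) * (t + s) - (z + B s ω) := by
    have := hB ω
    fun_prop
  obtain ⟨r, hrs, -, -, hr⟩ := exists_hitTimeFrom_le_of_nonpos (f := fun s ω => z + B s ω)
    (pred := fun s v => v = A + (η + γ) * (t + s)) (τ := (hatTimes B γ η A t z (i + 1)).2)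
    hg (fun s hs => by linarith) hs h1
    (by rw [← hR]; nlinarith [mul_nonneg hη.le (add_nonneg ht hR0)]) (by linarith)
  exact h2.not_ge (hr.trans (ENNReal.ofReal_le_ofReal hrs))

variable [MeasurableSpace Ω] {P : Measure Ω} [IsProbabilityMeasure P]

/-- The passage from the `(i + 1)`-st upper time to the `i`-th one. -/
lemma lintegral_expMart_upperTime_succ (hB : IsBMFrom Ω P B 0)
    (hη : 0 < η) (hA : 0 < A) (ht : 0 ≤ t) (hz : γ * t ≤ z) {θ : ℝ} (hθ : γ + η < θ) (i : ℕ) :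
    ∫⁻ ω in {ω | (hatTimes B γ η A t z (i + 1)).1 ω ≠ ⊤},
        expMart B t z θ ((hatTimes B γ η A t z (i + 1)).1 ω).toReal ω ∂P
      = ∫⁻ ω in {ω | (hatTimes B γ η A t z i).1 ω ≠ ⊤},
        expMart B t z (2 * γ - θ) ((hatTimes B γ η A t z i).1 ω).toReal ω ∂P := by
  have hst := isStop_hatTimes hB.cont γ η A t z
  have hcast (N : ℕ) : (N : ℝ≥0∞) = ENNReal.ofReal (N : ℝ) := (ENNReal.ofReal_natCast N).symm
  rw [lintegral_expMart_eq_of_barrier hB t z θ A (γ + η) (hst (i + 1)).2 (hst (i + 1)).1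
    (upperTime_le B γ η A t z i) hθ.ne' fun ω N h1 h2 => ?_,
    ← lintegral_expMart_eq_of_barrier hB t z (2 * γ - θ) 0 γ (hst i).1 (hst (i + 1)).2
    (lowerTime_le B γ η A t z i) (by linarith) fun ω N h1 h2 => ?_]
  · have hm : MeasurableSet {ω | (hatTimes B γ η A t z (i + 1)).2 ω ≠ ⊤} :=
      ((hst (i + 1)).2.measurable hB (measurableSet_singleton ⊤)).compl
    refine setLIntegral_congr_fun hm fun ω hω => ?_
    have := lowerTime_spec hB.cont hB.start hη hA ht hz hω
    simpa using expMart_reflect (a := 0) θ (this.trans (zero_add _).symm)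
  · rw [hcast] at h1 h2
    have := lt_of_lt_lowerTime N.cast_nonneg h1 h2
    nlinarith
  · rw [hcast] at h1 h2
    have := lt_of_lt_upperTime hB.cont hB.start hη hA ht hz N.cast_nonneg h1 h2
    exact mul_le_mul_of_nonneg_left this.le (by linarith)

lemma lintegral_expMart_upperTime (hB : IsBMFrom Ω P B 0)
    (hη : 0 < η) (hA : 0 < A) (ht : 0 ≤ t) (hz : γ * t ≤ z) (i : ℕ) {θ : ℝ} (hθ : γ + η < θ) :
    ∫⁻ ω in {ω | (hatTimes B γ η A t z (i + 1)).1 ω ≠ ⊤},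
        expMart B t z θ ((hatTimes B γ η A t z (i + 1)).1 ω).toReal ω ∂P
      = ENNReal.ofReal (rexp (-A * (2 * (θ - γ) * i + 2 * η * i ^ 2)
          + (2 * γ - θ - 2 * η * i) * z - (2 * γ - θ - 2 * η * i) ^ 2 / 2 * t)) := by
  induction i generalizing θ with
  | zero =>
    rw [lintegral_expMart_upperTime_succ hB hη hA ht hz hθ]
    simp [hatTimes, expMart, hB.start]
  | succ i ih =>
    rw [lintegral_expMart_upperTime_succ hB hη hA ht hz hθ]
    have hst := (isStop_hatTimes hB.cont γ η A t z (i + 1)).1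
    have hm : MeasurableSet {ω | (hatTimes B γ η A t z (i + 1)).1 ω ≠ ⊤} :=
      (hst.measurable hB (measurableSet_singleton ⊤)).compl
    have hr : ∀ ω ∈ {ω | (hatTimes B γ η A t z (i + 1)).1 ω ≠ ⊤},
        expMart B t z (2 * γ - θ) ((hatTimes B γ η A t z (i + 1)).1 ω).toReal ω
          = ENNReal.ofReal (rexp (2 * (2 * γ - θ - (γ + η)) * A)) *
            expMart B t z (θ + 2 * η) ((hatTimes B γ η A t z (i + 1)).1 ω).toReal ω := by
      intro ω hω
      rw [expMart_reflect (2 * γ - θ) (upperTime_spec hB.cont hω)]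
      congr 2
      ring
    rw [setLIntegral_congr_fun hm hr, lintegral_const_mul _
      (measurable_expMart hB t z _ (hst.measurable hB).ennreal_toReal), ih (by linarith),
      ← ENNReal.ofReal_mul (exp_nonneg _), ← Real.exp_add]
    congr 2
    push_cast
    ring

end HatTimes

section Moments

variable [MeasurableSpace Ω] {P : Measure Ω} [IsProbabilityMeasure P] {γ η A t z : ℝ}

lemma lintegral_exp_upperTime (hB : IsBMFrom Ω P B 0)
    (hη : 0 < η) (hA : 0 < A) (ht : 0 ≤ t) (hz : γ * t ≤ z) (i : ℕ) {θ : ℝ} (hθ : γ + η < θ) :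
    ∫⁻ ω in {ω | (hatTimes B γ η A t z (i + 1)).1 ω ≠ ⊤}, ENNReal.ofReal
        (rexp ((θ * (γ + η) - θ ^ 2 / 2) * (((hatTimes B γ η A t z (i + 1)).1 ω).toReal + t))) ∂P
      = ENNReal.ofReal (rexp (-θ * A - A * (2 * (θ - γ) * i + 2 * η * i ^ 2)
          + (2 * γ - θ - 2 * η * i) * z - (2 * γ - θ - 2 * η * i) ^ 2 / 2 * t)) := by
  have hst := (isStop_hatTimes hB.cont γ η A t z (i + 1)).1
  have hm : MeasurableSet {ω | (hatTimes B γ η A t z (i + 1)).1 ω ≠ ⊤} :=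
    (hst.measurable hB (measurableSet_singleton ⊤)).compl
  have hr : ∀ ω ∈ {ω | (hatTimes B γ η A t z (i + 1)).1 ω ≠ ⊤}, ENNReal.ofReal
        (rexp ((θ * (γ + η) - θ ^ 2 / 2) * (((hatTimes B γ η A t z (i + 1)).1 ω).toReal + t)))
      = ENNReal.ofReal (rexp (-θ * A)) *
          expMart B t z θ ((hatTimes B γ η A t z (i + 1)).1 ω).toReal ω := by
    intro ω hω
    rw [expMart, upperTime_spec hB.cont hω, ← ENNReal.ofReal_mul (exp_nonneg _), ← Real.exp_add]
    ring_nf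
  rw [setLIntegral_congr_fun hm hr, lintegral_const_mul _
    (measurable_expMart hB t z _ (hst.measurable hB).ennreal_toReal),
    lintegral_expMart_upperTime hB hη hA ht hz i hθ, ← ENNReal.ofReal_mul (exp_nonneg _),
    ← Real.exp_add]
  ring_nf

/-- The contribution of the `n`-th excursion to `Fhat`. -/
def excursionTerm (γ η A t : ℝ) (n : ℕ) (z : ℝ) : ℝ :=
  rexp (-γ * A - 2 * η * A * n ^ 2) * (2 * A * n + z - (γ - 2 * η * n) * t)
    * rexp ((γ - 2 * η * n) * z - (γ - 2 * η * n) ^ 2 / 2 * t)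

lemma lintegral_bmTerm_upperTime (hB : IsBMFrom Ω P B 0)
    (hη : 0 < η) (hA : 0 < A) (ht : 0 ≤ t) (hz : γ * t ≤ z) (i : ℕ) :
    ∫⁻ ω, bmTerm γ η A t ((hatTimes B γ η A t z (i + 1)).1 ω) ∂P
      = ENNReal.ofReal (excursionTerm γ η A t (i + 1) z) := by
  set T := (hatTimes B γ η A t z (i + 1)).1 with hT
  set X : Ω → ℝ := fun ω => (T ω).toReal + t with hX
  set μ := P.restrict {ω | T ω ≠ ⊤} with hμ
  set κ := γ * η + γ ^ 2 / 2 with hκ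
  have hTm : Measurable T := (isStop_hatTimes hB.cont γ η A t z (i + 1)).1.measurable hB
  have hXm : Measurable X := hTm.ennreal_toReal.add_const _
  have hm : MeasurableSet {ω | T ω ≠ ⊤} := (hTm (measurableSet_singleton ⊤)).compl
  set φ : ℝ → ℝ := fun θ => -θ * A - A * (2 * (θ - γ) * i + 2 * η * i ^ 2)
    + (2 * γ - θ - 2 * η * i) * z - (2 * γ - θ - 2 * η * i) ^ 2 / 2 * t with hφ
  set q : ℝ → ℝ := fun θ => θ * (γ + η) - θ ^ 2 / 2 with hq
  have hlin {θ : ℝ} (hθ : γ + η < θ) :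
      ∫⁻ ω, ENNReal.ofReal (rexp (q θ * X ω)) ∂μ = ENNReal.ofReal (rexp (φ θ)) :=
    lintegral_exp_upperTime hB hη hA ht hz i hθ
  have hint {θ : ℝ} (hθ : γ + η < θ) : Integrable (fun ω => rexp (q θ * X ω)) μ := by
    refine ⟨(by fun_prop : Measurable _).aestronglyMeasurable, ?_⟩
    rw [hasFiniteIntegral_iff_ofReal (.of_forall fun _ => exp_nonneg _), hlin hθ]
    exact ENNReal.ofReal_lt_top
  have hmgf {θ : ℝ} (hθ : γ + η < θ) : mgf X μ (q θ) = rexp (φ θ) := by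
    rw [mgf, integral_eq_lintegral_of_nonneg_ae (.of_forall fun _ => exp_nonneg _)
      (hint hθ).aestronglyMeasurable, hlin hθ, ENNReal.toReal_ofReal (exp_nonneg _)]
  have hθ0 : γ + η < γ + 2 * η := by linarith
  have hqκ : q (γ + 2 * η) = κ := by simp only [hq, hκ]; ring
  have hsub : Set.Iio ((γ + η) ^ 2 / 2) ⊆ integrableExpSet X μ := by
    intro p hp
    have hp' : 0 < (γ + η) ^ 2 - 2 * p := by
      have := Set.mem_Iio.1 hp
      linarith
    have h := hint (θ := γ + η + √((γ + η) ^ 2 - 2 * p))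
      (lt_add_of_pos_right _ (Real.sqrt_pos.2 hp'))
    have hqp : q (γ + η + √((γ + η) ^ 2 - 2 * p)) = p := by
      simp only [hq]
      nlinarith [Real.sq_sqrt hp'.le]
    rwa [hqp] at h
  have hκint : κ ∈ interior (integrableExpSet X μ) := by
    refine interior_maximal hsub isOpen_Iio (Set.mem_Iio.2 ?_)
    rw [hκ]
    nlinarith
  have hd1 := hasDerivAt_mgf hκint
  have hdq : HasDerivAt q (-η) (γ + 2 * η) := by
    have := ((hasDerivAt_id (γ + 2 * η)).mul_const (γ + η)).sub
      (((hasDerivAt_id (γ + 2 * η)).pow 2).div_const 2)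
    exact HasDerivAt.congr_deriv (f := q) this (by simp; ring)
  have hdφ : HasDerivAt φ (A - (2 * A * (i + 1) + z - (γ - 2 * η * (i + 1)) * t))
      (γ + 2 * η) := by
    have hid := hasDerivAt_id (γ + 2 * η)
    have hϑ : HasDerivAt (fun θ : ℝ => 2 * γ - θ - 2 * η * i) (-1) (γ + 2 * η) := by
      simpa using (hid.const_sub (2 * γ)).sub_const (2 * η * i)
    have := (((hid.neg.mul_const A).sub
      (((((hid.sub_const γ).const_mul 2).mul_const (i : ℝ)).add_const
        (2 * η * (i : ℝ) ^ 2)).const_mul A)).add (hϑ.mul_const z)).sub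
        (((hϑ.pow 2).div_const 2).mul_const t)
    exact HasDerivAt.congr_deriv (f := φ) this (by simp; ring)
  rw [← hqκ] at hd1
  have hcomp := hd1.comp (γ + 2 * η) hdq
  have heq : mgf X μ ∘ q =ᶠ[𝓝 (γ + 2 * η)] fun θ => rexp (φ θ) := by
    filter_upwards [lt_mem_nhds hθ0] with θ hθ using hmgf hθ
  have huniq := (hcomp.congr_of_eventuallyEq heq.symm).unique hdφ.exp
  rw [hqκ] at huniq
  have hi1 := hint hθ0
  rw [hqκ] at hi1
  have hi2 : Integrable (fun ω => X ω * rexp (κ * X ω)) μ := by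
    simpa using integrable_pow_mul_exp_of_mem_interior_integrableExpSet hκint 1
  have hX0 (ω : Ω) : 0 ≤ X ω := add_nonneg ENNReal.toReal_nonneg ht
  have hval : ∫ ω, (A + η * X ω) * rexp (κ * X ω) ∂μ = excursionTerm γ η A t (i + 1) z := by
    have h1 : ∫ ω, rexp (κ * X ω) ∂μ = rexp (φ (γ + 2 * η)) := by
      rw [← hmgf hθ0, hqκ, mgf]
    have h2 : (fun ω => (A + η * X ω) * rexp (κ * X ω))
        = fun ω => A * rexp (κ * X ω) + η * (X ω * rexp (κ * X ω)) := by
      ext ω; ring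
    have h3 : rexp (φ (γ + 2 * η)) = rexp (-γ * A - 2 * η * A * (i + 1) ^ 2) *
        rexp ((γ - 2 * η * (i + 1)) * z - (γ - 2 * η * (i + 1)) ^ 2 / 2 * t) := by
      rw [← Real.exp_add]
      congr 1
      simp only [hφ]
      ring
    rw [h2, integral_add (hi1.const_mul A) (hi2.const_mul η), integral_const_mul,
      integral_const_mul, h1, excursionTerm]
    push_cast
    linear_combination (-1 : ℝ) * huniq + (2 * A * (i + 1) + z - (γ - 2 * η * (i + 1)) * t) * h3
  rw [← hval, ofReal_integral_eq_lintegral_ofReal]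
  · rw [← lintegral_indicator hm]
    refine lintegral_congr fun ω => ?_
    by_cases h : T ω = ⊤
    · simp [bmTerm, h]
    · rw [Set.indicator_of_mem (s := {ω | T ω ≠ ⊤}) h, bmTerm, if_neg h]
  · have := (hi1.const_mul A).add (hi2.const_mul η)
    refine this.congr (.of_forall fun ω => ?_)
    simp only [Pi.add_apply]
    ring
  · exact .of_forall fun ω => mul_nonneg (by have := hX0 ω; positivity) (exp_nonneg _)

lemma Fhat_eq_tsum (hB : IsBMFrom Ω P B 0)
    (hη : 0 < η) (hA : 0 < A) (ht : 0 ≤ t) (hz : γ * t ≤ z) :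
    Fhat P B γ η A t z = ∑' i : ℕ, ENNReal.ofReal (excursionTerm γ η A t (i + 1) z) := by
  have hm : Measurable (bmTerm γ η A t) := by
    refine Measurable.ite (measurableSet_singleton ⊤) measurable_const ?_
    fun_prop
  have hm' (i : ℕ) : AEMeasurable
      (fun ω => bmTerm γ η A t ((hatTimes B γ η A t z (i + 1)).1 ω)) P :=
    (hm.comp ((isStop_hatTimes hB.cont γ η A t z (i + 1)).1.measurable hB)).aemeasurable
  rw [Fhat, lintegral_tsum hm']
  exact tsum_congr fun i => lintegral_bmTerm_upperTime hB hη hA ht hz i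

end Moments

section Lipschitz

variable {γ η A t : ℝ}

lemma excursion_exponent_le (hγ : 0 < γ) (hη : 0 < η) (hA : 0 < A) {n : ℕ} (hn : 1 ≤ n) :
    -γ * A - 2 * η * A * n ^ 2 ≤ -(2 * η * A) * n := by
  have hn' : (1 : ℝ) ≤ n := by exact_mod_cast hn
  have h1 : (n : ℝ) ≤ n ^ 2 := by nlinarith
  have h2 : 2 * η * A * n ≤ 2 * η * A * n ^ 2 := mul_le_mul_of_nonneg_left h1 (by positivity)
  nlinarith [mul_pos hγ hA]

lemma exp_drift_le (hγ : 0 < γ) (ht : 0 ≤ t) {p z : ℝ} (hp : 0 ≤ p) :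
    rexp (-p * z - p ^ 2 / 2 * t) ≤ rexp (-(p * (z - γ * t))) := by
  gcongr
  have : 0 ≤ p * (γ * t) := by positivity
  have : 0 ≤ p ^ 2 / 2 * t := by positivity
  nlinarith

lemma hasDerivAt_excursionTerm (γ η A t : ℝ) (n : ℕ) (z : ℝ) :
    HasDerivAt (excursionTerm γ η A t n) (rexp (-γ * A - 2 * η * A * n ^ 2) *
      ((1 + (γ - 2 * η * n) * (2 * A * n + z - (γ - 2 * η * n) * t))
        * rexp ((γ - 2 * η * n) * z - (γ - 2 * η * n) ^ 2 / 2 * t))) z := by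
  have hid := hasDerivAt_id z
  have := (((hid.const_add (2 * A * n)).sub_const ((γ - 2 * η * n) * t)).const_mul
    (rexp (-γ * A - 2 * η * A * n ^ 2))).mul
    (((hid.const_mul (γ - 2 * η * n)).sub_const ((γ - 2 * η * n) ^ 2 / 2 * t)).exp)
  exact HasDerivAt.congr_deriv (f := excursionTerm γ η A t n) this (by simp; ring)

lemma abs_excursionTerm_sub_le (hγ : 0 < γ) (hη : 0 < η) (hγη : γ < 2 * η) (hA : 0 < A)
    (ht : 0 ≤ t) {n : ℕ} (hn : 1 ≤ n) {x y : ℝ} (hx : γ * t ≤ x) (hy : γ * t ≤ y) :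
    |excursionTerm γ η A t n x - excursionTerm γ η A t n y|
      ≤ rexp (-(2 * η * A) * n) * (2 + 4 * η * (A + η) * n ^ 2) * (t + 1) * |x - y| := by
  have hn' : (1 : ℝ) ≤ n := by exact_mod_cast hn
  refine (convex_Ici (γ * t)).norm_image_sub_le_of_norm_hasDerivWithin_le
    (fun z _ => (hasDerivAt_excursionTerm γ η A t n z).hasDerivWithinAt) (fun z hz => ?_) hy hx
  have hz' : 0 ≤ z - γ * t := sub_nonneg.2 hz
  obtain ⟨p, hp⟩ : ∃ p, p = 2 * η * n - γ := ⟨_, rfl⟩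
  obtain ⟨d, hd⟩ : ∃ d, d = z - γ * t := ⟨_, rfl⟩
  have hp0 : 0 ≤ p := by rw [hp]; nlinarith
  have hϑ : γ - 2 * η * n = -p := by rw [hp]; ring
  have hpn : p ≤ 2 * η * n := by linarith
  rw [← hd] at hz'
  have hE : rexp (-p * z - (-p) ^ 2 / 2 * t) ≤ rexp (-(p * d)) := by
    rw [neg_sq, hd]
    exact exp_drift_le hγ ht hp0
  have hpd : 0 ≤ p * d := mul_nonneg hp0 hz'
  have hmul : p * d * rexp (-(p * d)) ≤ 1 := by
    have := Real.add_one_le_exp (p * d)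
    rw [Real.exp_neg, mul_inv_le_iff₀ (exp_pos _)]
    linarith
  have hE1 : rexp (-(p * d)) ≤ 1 := Real.exp_le_one_iff.2 (by linarith)
  have hzd : 2 * A * n + z - -p * t = d + 2 * n * (A + η * t) := by rw [hp, hd]; ring
  have hw : 0 ≤ 2 * n * (A + η * t) := by positivity
  have hbr : |1 + -p * (2 * A * n + z - -p * t)| ≤ 1 + p * d + p * (2 * n * (A + η * t)) := by
    rw [hzd, abs_le]
    have := mul_nonneg hp0 hw
    constructor <;> nlinarith
  have hAt : A + η * t ≤ (A + η) * (t + 1) := by nlinarith [mul_nonneg hA.le ht]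
  have hfin : p * (2 * n * (A + η * t)) ≤ 4 * η * (A + η) * n ^ 2 * (t + 1) := by
    calc p * (2 * n * (A + η * t)) ≤ 2 * η * n * (2 * n * ((A + η) * (t + 1))) := by gcongr
      _ = _ := by ring
  rw [hϑ, Real.norm_eq_abs, abs_mul, abs_mul, abs_of_pos (exp_pos _), abs_of_pos (exp_pos _),
    mul_assoc (rexp _)]
  refine mul_le_mul (Real.exp_le_exp.2 (excursion_exponent_le hγ hη hA hn)) ?_ (by positivity) (exp_nonneg _)
  calc |1 + -p * (2 * A * n + z - -p * t)| * rexp (-p * z - (-p) ^ 2 / 2 * t)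
      ≤ (1 + p * d + p * (2 * n * (A + η * t))) * rexp (-(p * d)) := by gcongr
    _ = (1 + p * (2 * n * (A + η * t))) * rexp (-(p * d)) + p * d * rexp (-(p * d)) := by ring
    _ ≤ (1 + p * (2 * n * (A + η * t))) * 1 + 1 := by gcongr
    _ ≤ (2 + 4 * η * (A + η) * n ^ 2) * (t + 1) := by linarith

lemma excursionTerm_nonneg (hη : 0 < η) (hA : 0 < A) (ht : 0 ≤ t) (n : ℕ) {z : ℝ}
    (hz : γ * t ≤ z) : 0 ≤ excursionTerm γ η A t n z := by
  have h : 0 ≤ 2 * A * n + z - (γ - 2 * η * n) * t := by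
    have : 2 * A * n + z - (γ - 2 * η * n) * t = (z - γ * t) + 2 * A * n + 2 * η * n * t := by ring
    rw [this]
    have := sub_nonneg.2 hz
    positivity
  unfold excursionTerm
  positivity

lemma summable_excursionTerm (hγ : 0 < γ) (hη : 0 < η) (hγη : γ < 2 * η) (hA : 0 < A)
    (ht : 0 ≤ t) {z : ℝ} (hz : γ * t ≤ z) :
    Summable fun i : ℕ => excursionTerm γ η A t (i + 1) z := by
  have hr : 0 < 2 * η * A := by positivity
  have hs : Summable fun n : ℕ =>
      (z - γ * t) * ((n : ℝ) ^ 0 * rexp (-(2 * η * A) * n))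
        + (2 * A + 2 * η * t) * ((n : ℝ) ^ 1 * rexp (-(2 * η * A) * n)) :=
    ((Real.summable_pow_mul_exp_neg_nat_mul 0 hr).mul_left _).add
      ((Real.summable_pow_mul_exp_neg_nat_mul 1 hr).mul_left _)
  refine Summable.of_nonneg_of_le (fun i => excursionTerm_nonneg hη hA ht _ hz) (fun i => ?_)
    ((summable_nat_add_iff 1).2 hs)
  obtain ⟨n, hn⟩ : ∃ n, n = i + 1 := ⟨_, rfl⟩
  rw [← hn]
  have hn1 : 1 ≤ n := by omega
  have hn' : (1 : ℝ) ≤ n := by exact_mod_cast hn1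
  have hz' := sub_nonneg.2 hz
  have hp0 : 0 ≤ 2 * η * n - γ := by nlinarith
  have h1 : rexp ((γ - 2 * η * n) * z - (γ - 2 * η * n) ^ 2 / 2 * t) ≤ 1 := by
    have := exp_drift_le (z := z) hγ ht hp0
    rw [neg_sub, sub_sq_comm] at this
    exact this.trans (Real.exp_le_one_iff.2 (neg_nonpos.2 (mul_nonneg hp0 hz')))
  have h2 : 2 * A * n + z - (γ - 2 * η * n) * t = (z - γ * t) + (2 * A + 2 * η * t) * n := by ring
  calc excursionTerm γ η A t n z
      ≤ rexp (-(2 * η * A) * n) * ((z - γ * t) + (2 * A + 2 * η * t) * n) * 1 := by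
        rw [excursionTerm, h2]
        gcongr
        exact excursion_exponent_le hγ hη hA hn1
    _ = _ := by ring

lemma summable_lipschitz_bound (hη : 0 < η) (hA : 0 < A) :
    Summable fun i : ℕ => rexp (-(2 * η * A) * (i + 1 : ℕ)) *
      (2 + 4 * η * (A + η) * ((i + 1 : ℕ) : ℝ) ^ 2) := by
  have hr : 0 < 2 * η * A := by positivity
  have hs := ((Real.summable_pow_mul_exp_neg_nat_mul 0 hr).mul_left 2).add
    ((Real.summable_pow_mul_exp_neg_nat_mul 2 hr).mul_left (4 * η * (A + η)))
  refine ((summable_nat_add_iff 1).2 hs).congr fun i => ?_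
  ring

end Lipschitz

end Auxiliary

/-- Lipschitz bound above the lower line: for `γ ∈ (0,1)`, `η > 0` with
`2η > γ` and `γ² + 2ηγ < 2`, and `A ≥ γ + η + 2`, there is `C = C(A,η,γ)` such that for all
`t ≥ 0` and all `x, y ≥ γ t`,
`|F_t(x) - F_t(y)| ≤ C (t+1) e^{(γη + γ²/2) t} |x - y|` (the expectations being finite). -/
theorem statement9 {Ω : Type} [MeasurableSpace Ω] (P : Measure Ω) [IsProbabilityMeasure P]
    (B : ℝ → Ω → ℝ) (hB : IsBMFrom Ω P B 0)
    (γ η A : ℝ) (hγ0 : 0 < γ) (hγ1 : γ < 1) (hη : 0 < η)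
    (h1 : γ < 2 * η) (h2 : γ ^ 2 + 2 * η * γ < 2) (hA : γ + η + 2 ≤ A) :
    ∃ C : ℝ, 0 < C ∧ ∀ t : ℝ, 0 ≤ t → ∀ x y : ℝ, γ * t ≤ x → γ * t ≤ y →
      Fhat P B γ η A t x < ⊤ ∧
      |(Fhat P B γ η A t x).toReal - (Fhat P B γ η A t y).toReal|
        ≤ C * (t + 1) * Real.exp ((γ * η + γ ^ 2 / 2) * t) * |x - y| := by
  have hA0 : 0 < A := by linarith
  have hb := summable_lipschitz_bound hη hA0
  set b : ℕ → ℝ := fun i => rexp (-(2 * η * A) * (i + 1 : ℕ)) *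
      (2 + 4 * η * (A + η) * ((i + 1 : ℕ) : ℝ) ^ 2)
  have hb0 : 0 ≤ ∑' i, b i := tsum_nonneg fun i => by positivity
  refine ⟨∑' i, b i + 1, by linarith, fun t ht x y hx hy => ?_⟩
  have hF {z : ℝ} (hz : γ * t ≤ z) : Fhat P B γ η A t z
      = ENNReal.ofReal (∑' i : ℕ, excursionTerm γ η A t (i + 1) z) := by
    rw [Fhat_eq_tsum hB hη hA0 ht hz, ENNReal.ofReal_tsum_of_nonneg
      (fun i => excursionTerm_nonneg hη hA0 ht _ hz) (summable_excursionTerm hγ0 hη h1 hA0 ht hz)]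
  have hFr {z : ℝ} (hz : γ * t ≤ z) : (Fhat P B γ η A t z).toReal
      = ∑' i : ℕ, excursionTerm γ η A t (i + 1) z := by
    rw [hF hz, ENNReal.toReal_ofReal (tsum_nonneg fun i => excursionTerm_nonneg hη hA0 ht _ hz)]
  refine ⟨by rw [hF hx]; exact ENNReal.ofReal_lt_top, ?_⟩
  rw [hFr hx, hFr hy, ← (summable_excursionTerm hγ0 hη h1 hA0 ht hx).tsum_sub
    (summable_excursionTerm hγ0 hη h1 hA0 ht hy), ← Real.norm_eq_abs]
  have hle : ‖∑' i : ℕ, (excursionTerm γ η A t (i + 1) x - excursionTerm γ η A t (i + 1) y)‖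
      ≤ (∑' i, b i) * (t + 1) * |x - y| :=
    tsum_of_norm_bounded ((hb.hasSum.mul_right (t + 1)).mul_right |x - y|) fun i =>
      abs_excursionTerm_sub_le hγ0 hη h1 hA0 ht (Nat.le_add_left 1 i) hx hy
  have hexp : 1 ≤ rexp ((γ * η + γ ^ 2 / 2) * t) := Real.one_le_exp (by positivity)
  calc _ ≤ (∑' i, b i) * (t + 1) * |x - y| := hle
    _ ≤ (∑' i, b i + 1) * (t + 1) * 1 * |x - y| := by
        rw [mul_one]
        gcongr
        linarith
    _ ≤ _ := by gcongr
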